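/- Let m ≤ n and let A be an m×n complex matrix. Then E(A) − σ₁(A) ≤ √((m−1)·(tr(AA*) − σ₁(A)²)). -/

import Mathlib

open Matrix

/-- The singular values of a complex `m × n` matrix `A`, listed in decreasing order:
`singularValues A i` is the `i`-th largest square root of an eigenvalue of `A * Aᴴ`. -/
noncomputable def singularValues {m n : ℕ} (A : Matrix (Fin m) (Fin n) ℂ) : Fin m → ℝ :=
  fun i =>
    Real.sqrt ((Matrix.isHermitian_mul_conjTranspose_self A).eigenvalues
      (Tuple.sort (Matrix.isHermitian_mul_conjTranspose_self A).eigenvalues i.rev))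

/-- The energy of a matrix: the sum of its singular values. -/
noncomputable def energy {m n : ℕ} (A : Matrix (Fin m) (Fin n) ℂ) : ℝ :=
  ∑ i, singularValues A i

open scoped ComplexOrder in
/-- The squares of the singular values of `A` sum to `tr (A * Aᴴ)`. -/
theorem sum_sq_singularValues {m n : ℕ} (A : Matrix (Fin m) (Fin n) ℂ) :
    ∑ i, singularValues A i ^ 2 = (Matrix.trace (A * Aᴴ)).re := by
  have hA := Matrix.isHermitian_mul_conjTranspose_self A
  have hnonneg : ∀ i, 0 ≤ hA.eigenvalues i :=
    (Matrix.posSemidef_self_mul_conjTranspose A).eigenvalues_nonneg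
  have htrace : (Matrix.trace (A * Aᴴ)).re = ∑ i, hA.eigenvalues i := by
    simp [hA.trace_eq_sum_eigenvalues]
  rw [htrace]
  unfold singularValues
  generalize hA.eigenvalues = v at hnonneg ⊢
  simp only [Real.sq_sqrt (hnonneg _)]
  exact Equiv.sum_comp (Fin.revPerm.trans (Tuple.sort v)) v

/-- Cauchy–Schwarz for the sum of a real family with one entry removed. -/
theorem sum_sub_le_sqrt_card_sub_one_mul {ι : Type*} [Fintype ι] (f : ι → ℝ) (j : ι) :
    ∑ i, f i - f j ≤
      Real.sqrt (((Fintype.card ι : ℝ) - 1) * (∑ i, f i ^ 2 - f j ^ 2)) := by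
  classical
  have hcard : ((Finset.univ.erase j).card : ℝ) = (Fintype.card ι : ℝ) - 1 := by
    rw [Finset.cast_card_erase_of_mem (Finset.mem_univ j), Finset.card_univ]
  rw [← Finset.sum_erase_eq_sub (Finset.mem_univ j), ← Finset.sum_erase_eq_sub (Finset.mem_univ j),
    ← hcard]
  exact Real.le_sqrt_of_sq_le sq_sum_le_card_mul_sum_sq

/-- If `m ≤ n` and `A` is an `m × n` complex matrix, then
`E(A) - σ₁(A) ≤ √((m-1)·(tr(AA*) - σ₁(A)²))`. -/
theorem energy_sub_sigma1_le {m n : ℕ} (hm : 1 ≤ m) (hmn : m ≤ n)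
    (A : Matrix (Fin m) (Fin n) ℂ) :
    energy A - singularValues A ⟨0, by omega⟩ ≤
      Real.sqrt (((m : ℝ) - 1) *
        ((Matrix.trace (A * Aᴴ)).re - (singularValues A ⟨0, by omega⟩) ^ 2)) := by
  rw [← sum_sq_singularValues]
  simpa only [energy, Fintype.card_fin] using
    sum_sub_le_sqrt_card_sub_one_mul (singularValues A) ⟨0, by omega⟩
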